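/- Let SL(H) × SL(V) act on X = G(k, H ⊗ V) × G(H ⊗ V*, m), where the first factor is the Grassmannian of k-dimensional subspaces of H ⊗ V, the second the Grassmannian of m-dimensional quotients of H ⊗ V*, and SL(V) acts on V* by the transpose action; linearize by the ample line bundle (p, q), p, q > 0. A point (K, L) is unstable for the SL(V)-action if and only if there is a subspace V′ ⊆ V such that, with K′ = K ∩ (H ⊗ V′) and L′ the quotient of L by the image of H ⊗ W* → L (W* = ker(V* → V′*)), one has (p·dim K′ + q·dim L′)/dim V′ > (p·dim K + q·dim L)/dim V. -/

import Mathlib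

open TensorProduct

/-- A (diagonalized) one-parameter subgroup `λ : ℂ* → SL(V)`, recorded by its
integer weight decomposition `V = ⊕_z V_z`, where `λ(t)` acts on the weight
space `wt z` by `t^z`.  The condition `det λ(t) = 1` says that the weights sum
to zero, counted with multiplicity. -/
structure OneParamSubgroup (V : Type) [AddCommGroup V] [Module ℂ V] where
  /-- the weight spaces -/
  wt : ℤ → Submodule ℂ V
  /-- the finitely many occurring weights -/
  supp : Finset ℤ
  wt_eq_bot : ∀ z ∉ supp, wt z = ⊥
  /-- `V` is the internal direct sum of the weight spaces -/
  internal : DirectSum.IsInternal wt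
  /-- determinant one: the weights sum to zero with multiplicity -/
  trace_zero : (∑ z ∈ supp, z * (Module.finrank ℂ ↥(wt z) : ℤ)) = 0

/-- For a one-parameter subgroup `λ` of `SL(V)` acting on `A ⊗ V` (trivially
on `A`), `weightFlag A lam z = ⊕_{z' ≥ z} A ⊗ V_{z'} ⊆ A ⊗ V` is the subspace
of weights at least `z`. -/
noncomputable def weightFlag (A : Type) [AddCommGroup A] [Module ℂ A]
    {V : Type} [AddCommGroup V] [Module ℂ V]
    (lam : OneParamSubgroup V) (z : ℤ) : Submodule ℂ (A ⊗[ℂ] V) :=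
  ⨆ z' : ℤ, ⨆ _ : z ≤ z',
    LinearMap.range (LinearMap.lTensor A (lam.wt z').subtype)

/-- The Hilbert–Mumford weight of a point `K` of a Grassmannian of subspaces
of `A ⊗ V` with respect to a one-parameter subgroup `λ` of `SL(V)` (acting
trivially on `A`), for the Plücker polarization `O(1)`:
`Σ_z z · (dim(K ∩ F_{≥ z}) − dim(K ∩ F_{≥ z+1}))`, so that
`μ(K, λ) = − hmWeight A lam K`. -/
noncomputable def hmWeight (A : Type) [AddCommGroup A] [Module ℂ A]
    {V : Type} [AddCommGroup V] [Module ℂ V]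
    (lam : OneParamSubgroup V) (K : Submodule ℂ (A ⊗[ℂ] V)) : ℤ :=
  ∑ z ∈ lam.supp,
    z * ((Module.finrank ℂ ↥(K ⊓ weightFlag A lam z) : ℤ) -
      (Module.finrank ℂ ↥(K ⊓ weightFlag A lam (z + 1)) : ℤ))

/-- For a point of the Grassmannian `G(H ⊗ V*, m)` of `m`-dimensional
quotients `π : H ⊗ V* → L`, the corresponding point `W = L* ⊆ H* ⊗ V` of the
Grassmannian of subspaces, under the canonical identification
`(H ⊗ V*)* ≅ H* ⊗ V`. -/
noncomputable def dualPoint {H V L : Type} [AddCommGroup H] [Module ℂ H]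
    [AddCommGroup V] [Module ℂ V] [AddCommGroup L] [Module ℂ L]
    [FiniteDimensional ℂ H] [FiniteDimensional ℂ V]
    (π : (H ⊗[ℂ] Module.Dual ℂ V) →ₗ[ℂ] L) :
    Submodule ℂ (Module.Dual ℂ H ⊗[ℂ] V) :=
  LinearMap.range
    ((TensorProduct.congr (LinearEquiv.refl ℂ (Module.Dual ℂ H))
        (Module.evalEquiv ℂ V).symm).toLinearMap ∘ₗ
      (TensorProduct.dualDistribEquiv ℂ H (Module.Dual ℂ V)).symm.toLinearMap ∘ₗ
      π.dualMap)

/-- Hilbert–Mumford instability of a point `(K, L)` of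
`G(k, H ⊗ V) × G(H ⊗ V*, m)` (subspaces of `H ⊗ V` and `m`-dimensional
quotients `π : H ⊗ V* → L`) for the restricted `SL(V)`-action (acting on `V*`
by transpose), linearized by `(p, q)`: under the duality
`G(H ⊗ V*, m) ≅ G(m, H* ⊗ V)`, `L ↦ W = L*`, some one-parameter subgroup `λ`
of `SL(V)` has `μ((K, W), λ) < 0`. -/
noncomputable def QuotPairUnstable {H V L : Type} [AddCommGroup H] [Module ℂ H]
    [AddCommGroup V] [Module ℂ V] [AddCommGroup L] [Module ℂ L]
    [FiniteDimensional ℂ H] [FiniteDimensional ℂ V]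
    (p q : ℕ) (K : Submodule ℂ (H ⊗[ℂ] V))
    (π : (H ⊗[ℂ] Module.Dual ℂ V) →ₗ[ℂ] L) : Prop :=
  ∃ lam : OneParamSubgroup V,
    0 < (p : ℤ) * hmWeight H lam K +
      (q : ℤ) * hmWeight (Module.Dual ℂ H) lam (dualPoint π)

section TensorSubspaces

open Module

lemma range_lTensor_subtype_eq_map₂ (A : Type) [AddCommGroup A] [Module ℂ A] {V : Type}
    [AddCommGroup V] [Module ℂ V] (N : Submodule ℂ V) :
    LinearMap.range (LinearMap.lTensor A N.subtype) =
      Submodule.map₂ (TensorProduct.mk ℂ A V) ⊤ N := by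
  rw [LinearMap.lTensor, TensorProduct.range_map, LinearMap.range_id, Submodule.range_subtype]

lemma range_lTensor_subtype_bot (A : Type) [AddCommGroup A] [Module ℂ A] (V : Type)
    [AddCommGroup V] [Module ℂ V] :
    LinearMap.range (LinearMap.lTensor A (⊥ : Submodule ℂ V).subtype) = ⊥ := by
  rw [range_lTensor_subtype_eq_map₂, Submodule.map₂_bot_right]

lemma range_lTensor_subtype_top (A : Type) [AddCommGroup A] [Module ℂ A] (V : Type)
    [AddCommGroup V] [Module ℂ V] :
    LinearMap.range (LinearMap.lTensor A (⊤ : Submodule ℂ V).subtype) = ⊤ := by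
  rw [range_lTensor_subtype_eq_map₂, TensorProduct.map₂_mk_top_top_eq_top]

lemma finrank_range_lTensor_subtype (A : Type) [AddCommGroup A] [Module ℂ A] {V : Type}
    [AddCommGroup V] [Module ℂ V] (N : Submodule ℂ V) :
    finrank ℂ (LinearMap.range (LinearMap.lTensor A N.subtype)) = finrank ℂ A * finrank ℂ N := by
  rw [LinearMap.finrank_range_of_inj
    (Module.Flat.lTensor_preserves_injective_linearMap _ N.injective_subtype),
    finrank_tensorProduct]

end TensorSubspaces

section DualPoint

open Module

variable {H V L : Type} [AddCommGroup H] [Module ℂ H] [AddCommGroup V] [Module ℂ V]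
  [AddCommGroup L] [Module ℂ L] [FiniteDimensional ℂ H] [FiniteDimensional ℂ V]

/-- The canonical identification `(H ⊗ V*)* ≃ H* ⊗ V`. -/
noncomputable def dualTensorDualEquiv (H V : Type) [AddCommGroup H] [Module ℂ H]
    [AddCommGroup V] [Module ℂ V] [FiniteDimensional ℂ H] [FiniteDimensional ℂ V] :
    Dual ℂ (H ⊗[ℂ] Dual ℂ V) ≃ₗ[ℂ] Dual ℂ H ⊗[ℂ] V :=
  (TensorProduct.dualDistribEquiv ℂ H (Dual ℂ V)).symm.trans
    (TensorProduct.congr (LinearEquiv.refl ℂ (Dual ℂ H)) (evalEquiv ℂ V).symm)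

lemma dualTensorDualEquiv_symm_tmul_apply (φ : Dual ℂ H) (v : V) (h : H) (w : Dual ℂ V) :
    (dualTensorDualEquiv H V).symm (φ ⊗ₜ v) (h ⊗ₜ w) = φ h * w v :=
  TensorProduct.dualDistrib_apply φ (Dual.eval ℂ V v) h w

lemma dualPoint_eq_map (π : (H ⊗[ℂ] Dual ℂ V) →ₗ[ℂ] L) :
    dualPoint π =
      (LinearMap.range π.dualMap).map (dualTensorDualEquiv H V).toLinearMap := by
  rw [← LinearMap.range_comp]
  rfl

lemma range_lTensor_dual_eq_map_dualAnnihilator (V' : Submodule ℂ V) :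
    LinearMap.range (LinearMap.lTensor (Dual ℂ H) V'.subtype) =
      (LinearMap.range (LinearMap.lTensor H V'.dualAnnihilator.subtype)).dualAnnihilator.map
        (dualTensorDualEquiv H V).toLinearMap := by
  apply Submodule.eq_of_le_of_finrank_eq
  · rw [range_lTensor_subtype_eq_map₂, range_lTensor_subtype_eq_map₂, Submodule.map₂_le]
    intro φ _ v hv
    refine ⟨(dualTensorDualEquiv H V).symm (φ ⊗ₜ v), ?_, by simp⟩
    rw [SetLike.mem_coe, Submodule.mem_dualAnnihilator]
    intro x hx
    have hle : Submodule.map₂ (TensorProduct.mk ℂ H (Dual ℂ V)) ⊤ V'.dualAnnihilator ≤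
        LinearMap.ker ((dualTensorDualEquiv H V).symm (φ ⊗ₜ v)) := by
      rw [Submodule.map₂_le]
      intro h _ w hw
      rw [LinearMap.mem_ker, TensorProduct.mk_apply, dualTensorDualEquiv_symm_tmul_apply,
        (Submodule.mem_dualAnnihilator w).1 hw v hv, mul_zero]
    exact hle hx
  · rw [LinearEquiv.finrank_map_eq, finrank_range_lTensor_subtype, Subspace.dual_finrank_eq]
    have h₁ := Subspace.finrank_add_finrank_dualAnnihilator_eq
      (LinearMap.range (LinearMap.lTensor H V'.dualAnnihilator.subtype))
    have h₂ := Subspace.finrank_add_finrank_dualAnnihilator_eq V'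
    rw [finrank_range_lTensor_subtype, finrank_tensorProduct, Subspace.dual_finrank_eq, ← h₂,
      mul_add] at h₁
    omega

lemma finrank_dualPoint_inf_range_lTensor [FiniteDimensional ℂ L]
    {π : (H ⊗[ℂ] Dual ℂ V) →ₗ[ℂ] L} (hπ : Function.Surjective π) (V' : Submodule ℂ V) :
    finrank ℂ ↥(dualPoint π ⊓ LinearMap.range (LinearMap.lTensor (Dual ℂ H) V'.subtype)) =
      finrank ℂ (L ⧸ Submodule.map π
        (LinearMap.range (LinearMap.lTensor H V'.dualAnnihilator.subtype))) := by
  set R := LinearMap.range (LinearMap.lTensor H V'.dualAnnihilator.subtype) with hR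
  have hcomap : R.dualAnnihilator.comap π.dualMap = (R.map π).dualAnnihilator := by
    ext f
    simp [Submodule.mem_dualAnnihilator]
  rw [dualPoint_eq_map, range_lTensor_dual_eq_map_dualAnnihilator, ← hR,
    ← Submodule.map_inf _ (dualTensorDualEquiv H V).injective, LinearEquiv.finrank_map_eq,
    ← Submodule.map_comap_eq, hcomap,
    ← (Submodule.equivMapOfInjective π.dualMap
      (LinearMap.dualMap_injective_of_surjective hπ) _).finrank_eq]
  have h₁ := Subspace.finrank_add_finrank_dualAnnihilator_eq (R.map π)
  have h₂ := Submodule.finrank_quotient_add_finrank (R.map π)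
  omega

lemma finrank_dualPoint [FiniteDimensional ℂ L]
    {π : (H ⊗[ℂ] Dual ℂ V) →ₗ[ℂ] L} (hπ : Function.Surjective π) :
    finrank ℂ (dualPoint π) = finrank ℂ L := by
  rw [dualPoint_eq_map, LinearEquiv.finrank_map_eq, LinearMap.finrank_range_of_inj
    (LinearMap.dualMap_injective_of_surjective hπ), Subspace.dual_finrank_eq]

end DualPoint

namespace OneParamSubgroup

variable {V : Type} [AddCommGroup V] [Module ℂ V]

/-- The filtration of `V` by the subspaces of weights at least `z`. -/
def flag (lam : OneParamSubgroup V) (z : ℤ) : Submodule ℂ V :=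
  ⨆ z' : ℤ, ⨆ _ : z ≤ z', lam.wt z'

lemma weightFlag_eq (A : Type) [AddCommGroup A] [Module ℂ A] (lam : OneParamSubgroup V) (z : ℤ) :
    weightFlag A lam z = LinearMap.range (LinearMap.lTensor A (lam.flag z).subtype) := by
  rw [range_lTensor_subtype_eq_map₂]
  simp only [weightFlag, flag, range_lTensor_subtype_eq_map₂, Submodule.map₂_iSup_right]

lemma wt_le_flag (lam : OneParamSubgroup V) {z z' : ℤ} (h : z ≤ z') : lam.wt z' ≤ lam.flag z :=
  le_iSup₂_of_le z' h le_rfl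

lemma flag_le_iff (lam : OneParamSubgroup V) {z : ℤ} {N : Submodule ℂ V} :
    lam.flag z ≤ N ↔ ∀ z', z ≤ z' → lam.wt z' ≤ N :=
  iSup₂_le_iff

lemma flag_eq_sup (lam : OneParamSubgroup V) (z : ℤ) :
    lam.flag z = lam.wt z ⊔ lam.flag (z + 1) := by
  apply le_antisymm
  · rw [flag_le_iff]
    intro z' hz'
    rcases hz'.eq_or_lt with rfl | h
    · exact le_sup_left
    · exact (lam.wt_le_flag h).trans le_sup_right
  · refine sup_le (lam.wt_le_flag le_rfl) (lam.flag_le_iff.2 fun z' hz' => ?_)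
    exact lam.wt_le_flag (by omega)

lemma disjoint_wt_flag (lam : OneParamSubgroup V) (z : ℤ) :
    Disjoint (lam.wt z) (lam.flag (z + 1)) := by
  refine (lam.internal.submodule_iSupIndep z).mono_right (lam.flag_le_iff.2 fun z' hz' => ?_)
  exact le_iSup₂_of_le z' (by omega) le_rfl

lemma finrank_wt [FiniteDimensional ℂ V] (lam : OneParamSubgroup V) (z : ℤ) :
    (Module.finrank ℂ (lam.wt z) : ℤ) =
      Module.finrank ℂ (lam.flag z) - Module.finrank ℂ (lam.flag (z + 1)) := by
  have h := Submodule.finrank_sup_add_finrank_inf_eq (lam.wt z) (lam.flag (z + 1))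
  rw [(lam.disjoint_wt_flag z).eq_bot, finrank_bot, ← flag_eq_sup] at h
  omega

lemma flag_eq_flag_succ (lam : OneParamSubgroup V) {z : ℤ} (hz : z ∉ lam.supp) :
    lam.flag z = lam.flag (z + 1) := by
  rw [flag_eq_sup, lam.wt_eq_bot z hz, bot_sup_eq]

lemma flag_eq_top (lam : OneParamSubgroup V) {a : ℤ} (ha : ∀ z ∈ lam.supp, a ≤ z) :
    lam.flag a = ⊤ := by
  rw [eq_top_iff, ← ((DirectSum.isInternal_submodule_iff_iSupIndep_and_iSup_eq_top _).1
    lam.internal).2, iSup_le_iff]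
  intro z
  by_cases hz : z ∈ lam.supp
  · exact lam.wt_le_flag (ha z hz)
  · simp [lam.wt_eq_bot z hz]

lemma flag_eq_bot (lam : OneParamSubgroup V) {b : ℤ} (hb : ∀ z ∈ lam.supp, z < b) :
    lam.flag b = ⊥ := by
  rw [eq_bot_iff, flag_le_iff]
  intro z hz
  rw [lam.wt_eq_bot z fun h => (hb z h).not_ge hz]

/-- The weight of `lam` attached to a function of subspaces of `V`, such as their dimension. -/
def flagWeight (lam : OneParamSubgroup V) (F : Submodule ℂ V → ℤ) : ℤ :=
  ∑ z ∈ lam.supp, z * (F (lam.flag z) - F (lam.flag (z + 1)))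

lemma flagWeight_finrank [FiniteDimensional ℂ V] (lam : OneParamSubgroup V) :
    lam.flagWeight (fun N => (Module.finrank ℂ N : ℤ)) = 0 := by
  simp only [flagWeight, ← finrank_wt, lam.trace_zero]

end OneParamSubgroup

/-- Summation by parts for a sum of weighted successive differences. -/
lemma sum_range_mul_sub_succ (G : ℤ → ℤ) (a : ℤ) (n : ℕ) :
    ∑ i ∈ Finset.range n, (a + i) * (G (a + i) - G (a + i + 1)) =
      a * G a + ∑ i ∈ Finset.range n, G (a + i + 1) - (a + n) * G (a + n) := by
  induction n with
  | zero => simp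
  | succ n ih =>
    rw [Finset.sum_range_succ, Finset.sum_range_succ, ih]
    push_cast
    rw [← add_assoc]
    ring_nf

namespace OneParamSubgroup

variable {V : Type} [AddCommGroup V] [Module ℂ V]

lemma flagWeight_nonpos (lam : OneParamSubgroup V) {F : Submodule ℂ V → ℤ}
    (hbot : F ⊥ = 0) (htop : F ⊤ = 0) (hF : ∀ N, F N ≤ 0) : lam.flagWeight F ≤ 0 := by
  obtain ⟨a, ha⟩ := lam.supp.bddBelow
  obtain ⟨b, hb⟩ := lam.supp.bddAbove
  replace ha : ∀ z ∈ lam.supp, a ≤ z := fun z hz => ha hz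
  replace hb : ∀ z ∈ lam.supp, z ≤ b := fun z hz => hb hz
  set n := (b + 1 - a).toNat with hn
  have hsub : lam.supp ⊆ (Finset.range n).image fun i : ℕ => a + i := by
    intro z hz
    have h₁ := ha z hz
    have h₂ := hb z hz
    exact Finset.mem_image.2 ⟨(z - a).toNat, Finset.mem_range.2 (by omega), by omega⟩
  have hsum : lam.flagWeight F = ∑ i ∈ Finset.range n,
      (a + i) * (F (lam.flag (a + i)) - F (lam.flag (a + i + 1))) := by
    rw [flagWeight, Finset.sum_subset hsub, Finset.sum_image]
    · intro i _ j _ h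
      simpa using h
    · intro z _ hz
      rw [← lam.flag_eq_flag_succ hz, sub_self, mul_zero]
  have hend : lam.flag (a + n) = ⊥ := lam.flag_eq_bot fun z hz => by
    have h₁ := ha z hz
    have h₂ := hb z hz
    omega
  rw [hsum, sum_range_mul_sub_succ (fun z => F (lam.flag z)), lam.flag_eq_top ha, hend, hbot, htop]
  simpa using Finset.sum_nonpos fun (i : ℕ) (_ : i ∈ Finset.range n) =>
    hF (lam.flag (a + i + 1))

lemma exists_mul_finrank_lt_of_flagWeight_pos [FiniteDimensional ℂ V] (lam : OneParamSubgroup V)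
    {F : Submodule ℂ V → ℤ} (hbot : F ⊥ = 0) (h : 0 < lam.flagWeight F) :
    ∃ N : Submodule ℂ V,
      F ⊤ * Module.finrank ℂ N < F N * Module.finrank ℂ V := by
  by_contra! hle
  rcases Nat.eq_zero_or_pos (Module.finrank ℂ V) with h0 | hpos
  · have hsub : Subsingleton V := Module.finrank_zero_iff.1 h0
    have hz : lam.flagWeight F = 0 := Finset.sum_eq_zero fun z _ => by
      rw [Subsingleton.elim (lam.flag z) (lam.flag (z + 1)), sub_self, mul_zero]
    omega
  · have hG := lam.flagWeight_nonpos
      (F := fun N => F N * Module.finrank ℂ V - F ⊤ * Module.finrank ℂ N)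
      (by simp [hbot]) (by simp) (fun N => sub_nonpos.2 (hle N))
    have hlin : lam.flagWeight (fun N => F N * Module.finrank ℂ V - F ⊤ * Module.finrank ℂ N) =
        lam.flagWeight F * Module.finrank ℂ V -
          F ⊤ * lam.flagWeight (fun N => (Module.finrank ℂ N : ℤ)) := by
      simp only [flagWeight, Finset.sum_mul, Finset.mul_sum, ← Finset.sum_sub_distrib]
      exact Finset.sum_congr rfl fun z _ => by ring
    rw [hlin, flagWeight_finrank, mul_zero, sub_zero] at hG
    have : 0 < lam.flagWeight F * Module.finrank ℂ V := mul_pos h (by exact_mod_cast hpos)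
    omega

/-- The one-parameter subgroup acting with weight `r` on `N` and `s` on a complement `U`. -/
noncomputable def ofIsCompl {N U : Submodule ℂ V} (hNU : IsCompl N U) (r s : ℤ) (hrs : s < r)
    (htr : r * Module.finrank ℂ N + s * Module.finrank ℂ U = 0) : OneParamSubgroup V where
  wt z := if z = r then N else if z = s then U else ⊥
  supp := {r, s}
  wt_eq_bot z hz := by
    simp only [Finset.mem_insert, Finset.mem_singleton, not_or] at hz
    rw [if_neg hz.1, if_neg hz.2]
  internal := by
    rw [DirectSum.isInternal_submodule_iff_iSupIndep_and_iSup_eq_top]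
    constructor
    · intro z
      dsimp only
      split_ifs with h₁ h₂
      · refine hNU.disjoint.mono_right (iSup₂_le fun j hj => ?_)
        rw [if_neg (by omega)]
        split_ifs <;> simp
      · refine hNU.symm.disjoint.mono_right (iSup₂_le fun j hj => ?_)
        split_ifs <;> first | omega | simp
      · exact disjoint_bot_left
    · rw [eq_top_iff, ← hNU.sup_eq_top]
      refine sup_le (le_iSup_of_le r ?_) (le_iSup_of_le s ?_)
      · rw [if_pos rfl]
      · rw [if_neg hrs.ne, if_pos rfl]
  trace_zero := by
    rw [Finset.sum_pair hrs.ne', if_pos rfl, if_neg hrs.ne, if_pos rfl, htr]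

lemma flagWeight_ofIsCompl {N U : Submodule ℂ V} (hNU : IsCompl N U) (r s : ℤ) (hrs : s < r)
    (htr : r * Module.finrank ℂ N + s * Module.finrank ℂ U = 0) (F : Submodule ℂ V → ℤ) :
    (ofIsCompl hNU r s hrs htr).flagWeight F = r * (F N - F ⊥) + s * (F ⊤ - F N) := by
  set lam := ofIsCompl hNU r s hrs htr with hlam
  have hsupp : ∀ z ∈ lam.supp, z = r ∨ z = s := fun z hz => by simpa [hlam, ofIsCompl] using hz
  have hwt : lam.wt r = N := if_pos rfl
  have hflag_end : lam.flag (r + 1) = ⊥ := lam.flag_eq_bot fun z hz => by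
    rcases hsupp z hz with h | h <;> omega
  have hflag_r : lam.flag r = N := by rw [flag_eq_sup, hwt, hflag_end, sup_bot_eq]
  have hflag_s : lam.flag s = ⊤ := lam.flag_eq_top fun z hz => by
    rcases hsupp z hz with h | h <;> omega
  have hflag_mid : lam.flag (s + 1) = N := by
    apply le_antisymm
    · rw [flag_le_iff]
      intro z hz
      change (if z = r then N else if z = s then U else ⊥) ≤ N
      split_ifs <;> first | omega | simp
    · rw [← hwt]
      exact lam.wt_le_flag hrs
  change ∑ z ∈ ({r, s} : Finset ℤ), _ = _
  rw [Finset.sum_pair hrs.ne', hflag_end, hflag_r, hflag_s, hflag_mid]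

lemma exists_flagWeight_pos_iff [FiniteDimensional ℂ V] {F : Submodule ℂ V → ℤ}
    (hbot : F ⊥ = 0) :
    (∃ lam : OneParamSubgroup V, 0 < lam.flagWeight F) ↔
      ∃ N : Submodule ℂ V, F ⊤ * Module.finrank ℂ N < F N * Module.finrank ℂ V := by
  refine ⟨fun ⟨lam, h⟩ => lam.exists_mul_finrank_lt_of_flagWeight_pos hbot h, ?_⟩
  rintro ⟨N, hN⟩
  obtain ⟨U, hNU⟩ := N.exists_isCompl
  have hdim := Submodule.finrank_add_eq_of_isCompl hNU
  have hV : 0 < Module.finrank ℂ V := by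
    by_contra h0
    rw [show Module.finrank ℂ V = 0 by omega, show Module.finrank ℂ N = 0 by omega] at hN
    simp at hN
  refine ⟨ofIsCompl hNU (Module.finrank ℂ U) (-Module.finrank ℂ N) (by omega) (by ring), ?_⟩
  rw [flagWeight_ofIsCompl, hbot]
  rw [← hdim] at hN
  push_cast at hN
  linarith

end OneParamSubgroup

/-- Let `SL(H) × SL(V)` act on
`X = G(k, H ⊗ V) × G(H ⊗ V*, m)` (`SL(V)` acting on `V*` by transpose),
linearized by the ample line bundle `(p, q)`, `p, q > 0`.  A point `(K, L)`
(with `L` an `m`-dimensional quotient `π : H ⊗ V* → L`) is unstable for the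
`SL(V)`-action if and only if there is a subspace `V' ⊆ V` such that, with
`K' = K ∩ (H ⊗ V')` and `L'` the quotient of `L` by the image of
`H ⊗ W* → L` where `W* = ker(V* → V'*)` is the annihilator of `V'`,
`(p·dim K' + q·dim L') / dim V' > (p·dim K + q·dim L) / dim V`. -/
theorem statement14 (H V L : Type) [AddCommGroup H] [Module ℂ H]
    [AddCommGroup V] [Module ℂ V] [AddCommGroup L] [Module ℂ L]
    [FiniteDimensional ℂ H] [FiniteDimensional ℂ V] [FiniteDimensional ℂ L]
    (p q k m : ℕ) (hp : 0 < p) (hq : 0 < q)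
    (K : Submodule ℂ (H ⊗[ℂ] V)) (hK : Module.finrank ℂ ↥K = k)
    (π : (H ⊗[ℂ] Module.Dual ℂ V) →ₗ[ℂ] L)
    (hπ : Function.Surjective π) (hL : Module.finrank ℂ L = m) :
    QuotPairUnstable p q K π ↔
      ∃ V' : Submodule ℂ V,
        (p * Module.finrank ℂ
            ↥(K ⊓ LinearMap.range (LinearMap.lTensor H V'.subtype)) +
         q * Module.finrank ℂ
            (L ⧸ Submodule.map π (LinearMap.range
              (LinearMap.lTensor H (Submodule.dualAnnihilator V').subtype)))) *
          Module.finrank ℂ V >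
        (p * Module.finrank ℂ ↥K + q * Module.finrank ℂ L) *
          Module.finrank ℂ ↥V' := by
  set F : Submodule ℂ V → ℤ := fun N =>
    p * Module.finrank ℂ ↥(K ⊓ LinearMap.range (LinearMap.lTensor H N.subtype)) +
      q * Module.finrank ℂ ↥(dualPoint π ⊓
        LinearMap.range (LinearMap.lTensor (Module.Dual ℂ H) N.subtype)) with hF
  have hbot : F ⊥ = 0 := by
    simp only [hF]
    rw [range_lTensor_subtype_bot, range_lTensor_subtype_bot, inf_bot_eq, inf_bot_eq,
      finrank_bot, finrank_bot]
    simp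
  have htop : F ⊤ = p * Module.finrank ℂ ↥K + q * Module.finrank ℂ L := by
    simp only [hF]
    rw [range_lTensor_subtype_top, range_lTensor_subtype_top, inf_top_eq, inf_top_eq,
      finrank_dualPoint hπ]
  have hunstable : QuotPairUnstable p q K π ↔
      ∃ lam : OneParamSubgroup V, 0 < lam.flagWeight F := by
    refine exists_congr fun lam => ?_
    simp only [hmWeight, OneParamSubgroup.flagWeight, hF, Finset.mul_sum,
      ← Finset.sum_add_distrib]
    refine iff_of_eq (congrArg _ (Finset.sum_congr rfl fun z _ => ?_))
    rw [OneParamSubgroup.weightFlag_eq, OneParamSubgroup.weightFlag_eq,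
      OneParamSubgroup.weightFlag_eq, OneParamSubgroup.weightFlag_eq]
    ring
  rw [hunstable, OneParamSubgroup.exists_flagWeight_pos_iff hbot, htop]
  refine exists_congr fun V' => ?_
  simp only [hF, finrank_dualPoint_inf_range_lTensor hπ, gt_iff_lt]
  norm_cast
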